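/- Let n = 2m+1 be odd with n ≥ 7. Suppose that for every triple (a,b,c) ∈ E_n^{(1)} ∪ E_n^{(2)} there are chosen nonnegative real numbers θ_{n,(a,b,c)}^{(b)} and θ_{n,(a,b,c)}^{(c)} with θ_{n,(a,b,c)}^{(b)} + θ_{n,(a,b,c)}^{(c)} = θ_{n,(a,b,c)}. For 1 ≤ u ≤ v ≤ m define L_{uv} = ∑_{c : (u,v,c) ∈ E_n^{(1)}∪E_n^{(2)}} θ_{n,(u,v,c)}^{(c)} + ∑_{b : (u,b,v) ∈ E_n^{(1)}∪E_n^{(2)}} θ_{n,(u,b,v)}^{(b)}, and for 1 ≤ j ≤ m define R_j = ∑_{(a,b) : (a,b,j) ∈ E_n^{(1)}∪E_n^{(2)}} θ_{n,(a,b,j)}^{(c)}·A_{n,(a,b,j)}^{(c)} + ∑_{(a,c) : (a,j,c) ∈ E_n^{(1)}∪E_n^{(2)}} θ_{n,(a,j,c)}^{(b)}·A_{n,(a,j,c)}^{(b)}. Assume: (1) L_{uv} ≤ 2 for all 1 ≤ u < v ≤ m; (2) L_{uu} ≤ 1 for all 1 ≤ u ≤ m; (3) R_j ≤ 2·(j−1)·sin²(πj/n)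 for all 1 ≤ j ≤ m. Then Q_{n,2}(x) + Q_{n,4}(x) − Q_{n,3}(x) ≥ 0 for all x ∈ ℝ_+^m. -/

import Mathlib

/-- `N_{(a,b,c)}`: the number of distinct ordered triples obtained by permuting `(a,b,c)`. -/
def Ntriple (p : ℕ × ℕ × ℕ) : ℕ :=
  ({(p.1, p.2.1, p.2.2), (p.1, p.2.2, p.2.1), (p.2.1, p.1, p.2.2),
    (p.2.1, p.2.2, p.1), (p.2.2, p.1, p.2.1), (p.2.2, p.2.1, p.1)} : Finset (ℕ × ℕ × ℕ)).card

/-- The weight `θ_{n,(a,b,c)} = N_{(a,b,c)}/3`. -/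
noncomputable def thetaTri (p : ℕ × ℕ × ℕ) : ℝ := (Ntriple p : ℝ) / 3

/-- `w_{n,(a,b,c)} = sin²(πa/n) + sin²(πb/n) + sin²(πc/n)`. -/
noncomputable def wTri (n : ℕ) (p : ℕ × ℕ × ℕ) : ℝ :=
  Real.sin (Real.pi * p.1 / n) ^ 2 + Real.sin (Real.pi * p.2.1 / n) ^ 2 +
    Real.sin (Real.pi * p.2.2 / n) ^ 2

/-- `A_{n,(a,b,c)}^{(c)} = w²/(4(sin²(πa/n)+sin²(πb/n)))`. -/
noncomputable def AcTri (n : ℕ) (p : ℕ × ℕ × ℕ) : ℝ :=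
  wTri n p ^ 2 / (4 * (Real.sin (Real.pi * p.1 / n) ^ 2 + Real.sin (Real.pi * p.2.1 / n) ^ 2))

/-- `A_{n,(a,b,c)}^{(b)} = w²/(4(sin²(πa/n)+sin²(πc/n)))`. -/
noncomputable def AbTri (n : ℕ) (p : ℕ × ℕ × ℕ) : ℝ :=
  wTri n p ^ 2 / (4 * (Real.sin (Real.pi * p.1 / n) ^ 2 + Real.sin (Real.pi * p.2.2 / n) ^ 2))

/-- The index set `E_n`: triples `1 ≤ a ≤ b ≤ c ≤ ⌊n/2⌋` with `a+b = c` or `a+b+c = n`.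
For odd `n = 2m+1` this is `E_n^{(1)} ∪ E_n^{(2)}`, and for even `n = 2m` it is
`E_n^{(1)} ∪ E_n^{(2)} ∪ E_n^{(3)}` (triples of `E_n^{(2)}` with `c = m` satisfy `a+b = m = c`
and hence coincide with `E_n^{(3)}`). -/
def Etri (n : ℕ) : Finset (ℕ × ℕ × ℕ) :=
  (Finset.range (n / 2 + 1) ×ˢ Finset.range (n / 2 + 1) ×ˢ Finset.range (n / 2 + 1)).filter
    fun p => 1 ≤ p.1 ∧ p.1 ≤ p.2.1 ∧ p.2.1 ≤ p.2.2 ∧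
      (p.1 + p.2.1 = p.2.2 ∨ p.1 + p.2.1 + p.2.2 = n)

/-- `Q_{n,3}(x) = (1/n³)·∑_{(a,b,c)∈E_n} θ_{n,(a,b,c)}·w_{n,(a,b,c)}·x_a·x_b·x_c`. -/
noncomputable def Q3 (n : ℕ) (x : ℕ → ℝ) : ℝ :=
  (1 / (n : ℝ) ^ 3) * ∑ p ∈ Etri n, thetaTri p * wTri n p * x p.1 * x p.2.1 * x p.2.2

/-- `Q_{n,2}`: for odd `n = 2m+1`, `(2/n²)·∑_{k=1}^{m}(k−1)·sin²(πk/n)·x_k²`; for even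
`n = 2m`, `(2/n²)·∑_{k=1}^{m−1}(k−1)·sin²(πk/n)·x_k² + ((m−1)/n²)·x_m²`. -/
noncomputable def Q2 (n : ℕ) (x : ℕ → ℝ) : ℝ :=
  if n % 2 = 1 then
    (2 / (n : ℝ) ^ 2) * ∑ k ∈ Finset.Icc 1 (n / 2),
      ((k : ℝ) - 1) * Real.sin (Real.pi * k / n) ^ 2 * x k ^ 2
  else
    (2 / (n : ℝ) ^ 2) * ∑ k ∈ Finset.Icc 1 (n / 2 - 1),
      ((k : ℝ) - 1) * Real.sin (Real.pi * k / n) ^ 2 * x k ^ 2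
    + (((n / 2 : ℕ) : ℝ) - 1) / (n : ℝ) ^ 2 * x (n / 2) ^ 2

/-- `Q_{n,4}`: for odd `n = 2m+1`, `(2/n⁴)(∑_{k=1}^m x_k²)(∑_{k=1}^m sin²(πk/n)x_k²)`; for
even `n = 2m`, `(2/n⁴)(∑_{k=1}^{m−1} x_k² + x_m²/2)(∑_{k=1}^{m−1} sin²(πk/n)x_k² + x_m²/2)`. -/
noncomputable def Q4 (n : ℕ) (x : ℕ → ℝ) : ℝ :=
  if n % 2 = 1 then
    (2 / (n : ℝ) ^ 4) * (∑ k ∈ Finset.Icc 1 (n / 2), x k ^ 2) *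
      (∑ k ∈ Finset.Icc 1 (n / 2), Real.sin (Real.pi * k / n) ^ 2 * x k ^ 2)
  else
    (2 / (n : ℝ) ^ 4) * ((∑ k ∈ Finset.Icc 1 (n / 2 - 1), x k ^ 2) + x (n / 2) ^ 2 / 2) *
      ((∑ k ∈ Finset.Icc 1 (n / 2 - 1), Real.sin (Real.pi * k / n) ^ 2 * x k ^ 2)
        + x (n / 2) ^ 2 / 2)

lemma fiber_pair_sum (m : ℕ) (E : Finset (ℕ × ℕ × ℕ)) (g h : ℕ × ℕ × ℕ → ℕ)
    (hg : ∀ p ∈ E, g p ∈ Finset.Icc 1 m) (hh : ∀ p ∈ E, h p ∈ Finset.Icc 1 m)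
    (t : ℕ × ℕ × ℕ → ℝ) (F : ℕ → ℕ → ℝ) :
    ∑ p ∈ E, t p * F (g p) (h p) =
      ∑ u ∈ Finset.Icc 1 m, ∑ v ∈ Finset.Icc 1 m,
        (∑ p ∈ E.filter fun p => g p = u ∧ h p = v, t p) * F u v := by
  rw [← Finset.sum_fiberwise_of_maps_to hg]
  refine Finset.sum_congr rfl fun u _ => ?_
  rw [← Finset.sum_fiberwise_of_maps_to
    (fun p hp => hh p (Finset.mem_of_mem_filter p hp))]
  refine Finset.sum_congr rfl fun v _ => ?_
  rw [Finset.filter_filter, Finset.sum_mul]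
  refine Finset.sum_congr rfl fun p hp => ?_
  obtain ⟨_, h1, h2⟩ := Finset.mem_filter.1 hp
  rw [h1, h2]

lemma fiber_single_sum (m : ℕ) (E : Finset (ℕ × ℕ × ℕ)) (g : ℕ × ℕ × ℕ → ℕ)
    (hg : ∀ p ∈ E, g p ∈ Finset.Icc 1 m)
    (t : ℕ × ℕ × ℕ → ℝ) (F : ℕ → ℝ) :
    ∑ p ∈ E, t p * F (g p) =
      ∑ u ∈ Finset.Icc 1 m, (∑ p ∈ E.filter fun p => g p = u, t p) * F u := by
  rw [← Finset.sum_fiberwise_of_maps_to hg]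
  refine Finset.sum_congr rfl fun u _ => ?_
  rw [Finset.sum_mul]
  refine Finset.sum_congr rfl fun p hp => ?_
  rw [(Finset.mem_filter.1 hp).2]

lemma amgm_aux (w S X Y : ℝ) (hS : 0 < S) :
    w * X * Y ≤ S * X ^ 2 + w ^ 2 / (4 * S) * Y ^ 2 := by
  have : S * X ^ 2 + w ^ 2 / (4 * S) * Y ^ 2 - w * X * Y
      = (2 * S * X - w * Y) ^ 2 / (4 * S) := by
    field_simp
    ring
  have h2 : 0 ≤ (2 * S * X - w * Y) ^ 2 / (4 * S) := by positivity
  linarith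

/-- Sufficient criterion (odd case `n = 2m+1 ≥ 7`): given a decomposition
`θ_{n,(a,b,c)} = θ^{(b)} + θ^{(c)}` into nonnegative parts on `E_n = E_n^{(1)} ∪ E_n^{(2)}`
such that `L_{uv} ≤ 2` for `u < v`, `L_{uu} ≤ 1` and `R_j ≤ 2(j−1)sin²(πj/n)`, one has
`Q_{n,2}(x) + Q_{n,4}(x) − Q_{n,3}(x) ≥ 0` for all `x ∈ ℝ_+^m`. -/
theorem decomposition_criterion_odd (m n : ℕ) (hm : 3 ≤ m) (hn : n = 2 * m + 1)
    (θb θc : ℕ × ℕ × ℕ → ℝ)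
    (hθb : ∀ p ∈ Etri n, 0 ≤ θb p) (hθc : ∀ p ∈ Etri n, 0 ≤ θc p)
    (hθ : ∀ p ∈ Etri n, θb p + θc p = thetaTri p)
    (hLlt : ∀ u v : ℕ, 1 ≤ u → u < v → v ≤ m →
      (∑ p ∈ (Etri n).filter fun p => p.1 = u ∧ p.2.1 = v, θc p)
        + (∑ p ∈ (Etri n).filter fun p => p.1 = u ∧ p.2.2 = v, θb p) ≤ 2)
    (hLeq : ∀ u : ℕ, 1 ≤ u → u ≤ m →
      (∑ p ∈ (Etri n).filter fun p => p.1 = u ∧ p.2.1 = u, θc p)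
        + (∑ p ∈ (Etri n).filter fun p => p.1 = u ∧ p.2.2 = u, θb p) ≤ 1)
    (hR : ∀ j : ℕ, 1 ≤ j → j ≤ m →
      (∑ p ∈ (Etri n).filter fun p => p.2.2 = j, θc p * AcTri n p)
        + (∑ p ∈ (Etri n).filter fun p => p.2.1 = j, θb p * AbTri n p)
        ≤ 2 * ((j : ℝ) - 1) * Real.sin (Real.pi * j / n) ^ 2)
    (x : ℕ → ℝ) (hx : ∀ i, 0 ≤ x i) :
    0 ≤ Q2 n x + Q4 n x - Q3 n x := by
  have hn2 : n / 2 = m := by omega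
  have hodd : n % 2 = 1 := by omega
  have hnpos : (0 : ℝ) < n := by
    have : 0 < n := by omega
    exact_mod_cast this
  have hE : ∀ p ∈ Etri n, 1 ≤ p.1 ∧ p.1 ≤ p.2.1 ∧ p.2.1 ≤ p.2.2 ∧ p.2.2 ≤ m := by
    intro p hp
    simp only [Etri, Finset.mem_filter, Finset.mem_product, Finset.mem_range, hn2] at hp
    omega
  have hE1 : ∀ p ∈ Etri n, p.1 ∈ Finset.Icc 1 m := fun p hp => by
    have := hE p hp
    rw [Finset.mem_Icc]; omega
  have hE2 : ∀ p ∈ Etri n, p.2.1 ∈ Finset.Icc 1 m := fun p hp => by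
    have := hE p hp
    rw [Finset.mem_Icc]; omega
  have hE3 : ∀ p ∈ Etri n, p.2.2 ∈ Finset.Icc 1 m := fun p hp => by
    have := hE p hp
    rw [Finset.mem_Icc]; omega
  obtain ⟨s, hs⟩ : ∃ s : ℕ → ℝ, ∀ k, s k = Real.sin (Real.pi * k / n) ^ 2 :=
    ⟨fun k => Real.sin (Real.pi * k / n) ^ 2, fun _ => rfl⟩
  have hs0 : ∀ k, 0 ≤ s k := fun k => by rw [hs]; positivity
  have hspos : ∀ k ∈ Finset.Icc 1 m, 0 < s k := by
    intro k hk
    rw [Finset.mem_Icc] at hk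
    have hk1 : (0 : ℝ) < k := by exact_mod_cast hk.1
    have hkn : (k : ℝ) < n := by
      have : k < n := by omega
      exact_mod_cast this
    rw [hs]
    have : 0 < Real.sin (Real.pi * k / n) := by
      apply Real.sin_pos_of_pos_of_lt_pi
      · have := Real.pi_pos
        positivity
      · rw [div_lt_iff₀ hnpos]
        exact mul_lt_mul_of_pos_left hkn Real.pi_pos
    positivity
  obtain ⟨F, hF⟩ : ∃ F : ℕ → ℕ → ℝ, ∀ u v, F u v = (s u + s v) * (x u * x v) ^ 2 :=
    ⟨fun u v => (s u + s v) * (x u * x v) ^ 2, fun _ _ => rfl⟩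
  have hF0 : ∀ u v, 0 ≤ F u v := fun u v => by
    rw [hF]
    have := hs0 u
    have := hs0 v
    positivity
  have hFsymm : ∀ u v, F u v = F v u := fun u v => by rw [hF, hF]; ring
  -- termwise bound
  have hterm : ∀ p ∈ Etri n, (n : ℝ) * (thetaTri p * wTri n p * x p.1 * x p.2.1 * x p.2.2) ≤
      (θc p * F p.1 p.2.1 + θb p * F p.1 p.2.2)
      + (n : ℝ) ^ 2 * ((θc p * AcTri n p) * x p.2.2 ^ 2 + (θb p * AbTri n p) * x p.2.1 ^ 2) := by
    intro p hp
    have h1 := hspos _ (hE1 p hp)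
    have h2 := hspos _ (hE2 p hp)
    have h3 := hspos _ (hE3 p hp)
    have hc := mul_le_mul_of_nonneg_left
      (amgm_aux (wTri n p) (s p.1 + s p.2.1) (x p.1 * x p.2.1) (n * x p.2.2) (by linarith))
      (hθc p hp)
    have hb := mul_le_mul_of_nonneg_left
      (amgm_aux (wTri n p) (s p.1 + s p.2.2) (x p.1 * x p.2.2) (n * x p.2.1) (by linarith))
      (hθb p hp)
    have eA : AcTri n p = wTri n p ^ 2 / (4 * (s p.1 + s p.2.1)) := by
      rw [AcTri, hs, hs]
    have eB : AbTri n p = wTri n p ^ 2 / (4 * (s p.1 + s p.2.2)) := by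
      rw [AbTri, hs, hs]
    rw [← eA] at hc
    rw [← eB] at hb
    rw [← hθ p hp, hF, hF]
    linarith
  have hsum := Finset.sum_le_sum hterm
  simp only [Finset.sum_add_distrib, ← Finset.mul_sum] at hsum
  rw [fiber_pair_sum m (Etri n) (fun p => p.1) (fun p => p.2.1) hE1 hE2 θc F,
    fiber_pair_sum m (Etri n) (fun p => p.1) (fun p => p.2.2) hE1 hE3 θb F,
    fiber_single_sum m (Etri n) (fun p => p.2.2) hE3 (fun p => θc p * AcTri n p)
      (fun k => x k ^ 2),
    fiber_single_sum m (Etri n) (fun p => p.2.1) hE2 (fun p => θb p * AbTri n p)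
      (fun k => x k ^ 2)] at hsum
  simp only [← Finset.sum_add_distrib, ← add_mul] at hsum
  -- the R part
  have hRsum := Finset.sum_le_sum (s := Finset.Icc 1 m) fun j hj =>
    mul_le_mul_of_nonneg_right (hR j (Finset.mem_Icc.1 hj).1 (Finset.mem_Icc.1 hj).2)
      (sq_nonneg (x j))
  -- the L part
  obtain ⟨L, hL⟩ : ∃ L : ℕ → ℕ → ℝ, ∀ u v, L u v =
      (∑ p ∈ (Etri n).filter fun p => p.1 = u ∧ p.2.1 = v, θc p)
        + (∑ p ∈ (Etri n).filter fun p => p.1 = u ∧ p.2.2 = v, θb p) := ⟨_, fun _ _ => rfl⟩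
  simp only [← hL] at hsum hLlt hLeq
  have hL0 : ∀ u v, v < u → L u v = 0 := by
    intro u v huv
    rw [hL, Finset.filter_false_of_mem, Finset.filter_false_of_mem]
    · simp
    · intro p hp
      have := hE p hp
      omega
    · intro p hp
      have := hE p hp
      omega
  have hLL : ∀ u ∈ Finset.Icc 1 m, ∀ v ∈ Finset.Icc 1 m, L u v + L v u ≤ 2 := by
    intro u hu v hv
    rw [Finset.mem_Icc] at hu hv
    rcases lt_trichotomy u v with h | h | h
    · rw [hL0 v u h]
      linarith [hLlt u v hu.1 h hv.2]
    · subst h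
      linarith [hLeq u hu.1 hu.2]
    · rw [hL0 u v h]
      linarith [hLlt v u hv.1 h hu.2]
  have hLsum : ∑ u ∈ Finset.Icc 1 m, ∑ v ∈ Finset.Icc 1 m, L u v * F u v ≤
      ∑ u ∈ Finset.Icc 1 m, ∑ v ∈ Finset.Icc 1 m, F u v := by
    have e : ∑ u ∈ Finset.Icc 1 m, ∑ v ∈ Finset.Icc 1 m, L u v * F u v =
        ∑ u ∈ Finset.Icc 1 m, ∑ v ∈ Finset.Icc 1 m, L v u * F u v := by
      rw [Finset.sum_comm]
      refine Finset.sum_congr rfl fun u _ => Finset.sum_congr rfl fun v _ => ?_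
      rw [hFsymm]
    have h := Finset.sum_le_sum fun u hu => Finset.sum_le_sum fun v hv =>
      mul_le_mul_of_nonneg_right (hLL u hu v hv) (hF0 u v)
    simp only [add_mul, Finset.sum_add_distrib, ← Finset.mul_sum] at h
    linarith
  have hFsum : ∑ u ∈ Finset.Icc 1 m, ∑ v ∈ Finset.Icc 1 m, F u v =
      2 * ((∑ k ∈ Finset.Icc 1 m, x k ^ 2) * (∑ k ∈ Finset.Icc 1 m, s k * x k ^ 2)) := by
    have e1 : ∀ u v, F u v = (s u * x u ^ 2) * x v ^ 2 + x u ^ 2 * (s v * x v ^ 2) :=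
      fun u v => by rw [hF]; ring
    simp only [e1, Finset.sum_add_distrib]
    rw [← Finset.sum_mul_sum, ← Finset.sum_mul_sum]
    ring
  have e2 : ∑ j ∈ Finset.Icc 1 m, 2 * ((j : ℝ) - 1) * Real.sin (Real.pi * j / n) ^ 2 * x j ^ 2 =
      2 * ∑ k ∈ Finset.Icc 1 m, ((k : ℝ) - 1) * s k * x k ^ 2 := by
    rw [Finset.mul_sum]
    refine Finset.sum_congr rfl fun k _ => ?_
    rw [hs]; ring
  rw [e2] at hRsum
  have hRsum2 := mul_le_mul_of_nonneg_left hRsum (sq_nonneg (n : ℝ))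
  rw [hFsum] at hLsum
  rw [Q2, Q4, Q3, if_pos hodd, if_pos hodd, hn2]
  simp only [← hs]
  set T := ∑ p ∈ Etri n, thetaTri p * wTri n p * x p.1 * x p.2.1 * x p.2.2
  set P := ∑ k ∈ Finset.Icc 1 m, ((k : ℝ) - 1) * s k * x k ^ 2
  set U := ∑ k ∈ Finset.Icc 1 m, x k ^ 2
  set V := ∑ k ∈ Finset.Icc 1 m, s k * x k ^ 2
  have key : 0 ≤ (n : ℝ) ^ 2 * (2 * P) + 2 * (U * V) - n * T := by linarith
  have e3 : 2 / (n : ℝ) ^ 2 * P + 2 / (n : ℝ) ^ 4 * U * V - 1 / (n : ℝ) ^ 3 * T =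
      ((n : ℝ) ^ 2 * (2 * P) + 2 * (U * V) - n * T) / (n : ℝ) ^ 4 := by
    field_simp
  rw [e3]
  positivity
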